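/- Let G be an amenable group (possibly uncountable) and let A be a finite set. Then every strongly irreducible subshift X ⊆ A^G has the Myhill property: every pre-injective cellular automaton τ : X → X is surjective. -/

import Mathlib

open Pointwise Filter

variable {G : Type*} [Group G]

/-- The shift action of `G` on configurations: `(g • x)(h) = x(g⁻¹h)`. -/
def shift {A : Type*} (g : G) (x : G → A) : G → A := fun h => x (g⁻¹ * h)

/-- A subshift: a closed, shift-invariant subset of `A^G` (prodiscrete topology). -/
def IsSubshift {A : Type*} [TopologicalSpace A] (X : Set (G → A)) : Prop :=
  IsClosed X ∧ ∀ g : G, ∀ x ∈ X, shift g x ∈ X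

/-- The `Δ`-neighborhood `Ω^{+Δ} = ΩΔ⁻¹ = {g : gΔ ∩ Ω ≠ ∅}`. -/
def plusNbhd (Ω Δ : Set G) : Set G := {g : G | ∃ d ∈ Δ, g * d ∈ Ω}

/-- `Δ`-irreducibility of a subshift. -/
def DeltaIrreducible {A : Type*} (Δ : Finset G) (X : Set (G → A)) : Prop :=
  ∀ Ω₁ Ω₂ : Finset G,
    plusNbhd (Ω₁ : Set G) (Δ : Set G) ∩ (Ω₂ : Set G) = ∅ →
    ∀ x₁ ∈ X, ∀ x₂ ∈ X,
      ∃ x ∈ X, (∀ g ∈ Ω₁, x g = x₁ g) ∧ (∀ g ∈ Ω₂, x g = x₂ g)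

/-- Strong irreducibility: `Δ`-irreducible for some finite `Δ ⊆ G`. -/
def StronglyIrreducible {A : Type*} (X : Set (G → A)) : Prop :=
  ∃ Δ : Finset G, DeltaIrreducible Δ X

/-- A cellular automaton between subshifts `X ⊆ A^G` and `Y ⊆ B^G`:
a map that sends `X` into `Y`, is continuous on `X`, and is `G`-equivariant on `X`. -/
def IsCellularAutomaton {A B : Type*} [TopologicalSpace A] [TopologicalSpace B]
    (X : Set (G → A)) (Y : Set (G → B)) (τ : (G → A) → (G → B)) : Prop :=
  Set.MapsTo τ X Y ∧ ContinuousOn τ X ∧ ∀ g : G, ∀ x ∈ X, τ (shift g x) = shift g (τ x)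

/-- Pre-injectivity of a map on a subshift `X`. -/
def PreInjective {A B : Type*} (X : Set (G → A)) (τ : (G → A) → (G → B)) : Prop :=
  ∀ x₁ ∈ X, ∀ x₂ ∈ X, {g : G | x₁ g ≠ x₂ g}.Finite → τ x₁ = τ x₂ → x₁ = x₂

/-- A Følner net for `G`, indexed by a directed preorder `J`. -/
def IsFolnerNet {J : Type*} [Preorder J] (F : J → Finset G) : Prop :=
  (∀ j, (F j).Nonempty) ∧
  ∀ E : Finset G,
    Tendsto (fun j => ((plusNbhd (F j : Set G) (E : Set G) \ (F j : Set G)).ncard : ℝ) /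
        ((F j).card : ℝ)) atTop (nhds 0)

/-- The entropy of a subset `X ⊆ A^G` with respect to a Følner net `F`. -/
noncomputable def entropy {J A : Type*} [Preorder J] (F : J → Finset G) (X : Set (G → A)) : ℝ :=
  limsup (fun j => Real.log (((Set.restrict (F j : Set G)) '' X).ncard : ℝ) / ((F j).card : ℝ))
    atTop

/-- Topological mixing for a subshift (open subsets of `X` are traces of ambient opens). -/
def TopologicallyMixing {A : Type*} [TopologicalSpace A] (X : Set (G → A)) : Prop :=
  ∀ U V : Set (G → A), IsOpen U → IsOpen V → (U ∩ X).Nonempty → (V ∩ X).Nonempty →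
    ∃ F : Finset G, ∀ g : G, g ∉ F → ((U ∩ X) ∩ (shift g '' (V ∩ X))).Nonempty

/-- An `(E,E')`-tiling. -/
def IsTiling (E E' T : Set G) : Prop :=
  T.PairwiseDisjoint (fun g => g • E) ∧ (⋃ g ∈ T, g • E') = Set.univ

theorem shift_inv_apply {A : Type*} (g h : G) (x : G → A) : shift g⁻¹ x h = x (g * h) := by
  simp [shift]

/-- An open neighborhood of a configuration contains a cylinder. -/
theorem exists_cylinder_subset {ι A : Type*} [TopologicalSpace A] [DiscreteTopology A]
    {U : Set (ι → A)} {x : ι → A} (hU : U ∈ nhds x) :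
    ∃ E : Finset ι, ∀ y : ι → A, (∀ e ∈ E, y e = x e) → y ∈ U := by
  obtain ⟨V, hVU, hV, hxV⟩ := mem_nhds_iff.1 hU
  obtain ⟨I, u, hu, hsub⟩ := isOpen_pi_iff.1 hV x hxV
  refine ⟨I, fun y hy => hVU (hsub fun i hi => ?_)⟩
  rw [hy i hi]
  exact (hu i hi).2

theorem isOpen_cylinder {ι A : Type*} [TopologicalSpace A] [DiscreteTopology A]
    (E : Finset ι) (x : ι → A) : IsOpen {y : ι → A | ∀ e ∈ E, y e = x e} := by
  have : {y : ι → A | ∀ e ∈ E, y e = x e} = (E : Set ι).pi fun e => {x e} := by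
    ext y; simp [Set.mem_pi]
  rw [this]
  exact isOpen_set_pi E.finite_toSet fun _ _ => isOpen_discrete _

/-- A cellular automaton on a closed subshift over a finite alphabet has a finite memory set. -/
theorem IsCellularAutomaton.exists_memory {A B : Type*} [Finite A]
    [TopologicalSpace A] [DiscreteTopology A] [TopologicalSpace B] [DiscreteTopology B]
    {X : Set (G → A)} {Y : Set (G → B)} {τ : (G → A) → (G → B)}
    (hX : IsSubshift X) (hτ : IsCellularAutomaton X Y τ) :
    ∃ M : Finset G, ∀ x ∈ X, ∀ y ∈ X, ∀ g : G, (∀ m ∈ M, x (g * m) = y (g * m)) →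
      τ x g = τ y g := by
  classical
  have hloc : ∀ x ∈ X, ∃ E : Finset G, ∀ y ∈ X, (∀ e ∈ E, y e = x e) → τ y 1 = τ x 1 := by
    intro x hx
    have hc : ContinuousWithinAt (fun z => τ z 1) X x :=
      (continuous_apply (1 : G)).continuousAt.comp_continuousWithinAt (hτ.2.1 x hx)
    have hmem := hc.preimage_mem_nhdsWithin (IsOpen.mem_nhds (isOpen_discrete {τ x 1}) rfl)
    obtain ⟨U, hU, hUX⟩ := mem_nhdsWithin_iff_exists_mem_nhds_inter.1 hmem
    obtain ⟨E, hE⟩ := exists_cylinder_subset hU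
    exact ⟨E, fun y hy h => hUX ⟨hE y h, hy⟩⟩
  choose! E hE using hloc
  obtain ⟨t, htX, ht⟩ := hX.1.isCompact.elim_nhds_subcover
    (fun x => {y : G → A | ∀ e ∈ E x, y e = x e})
    (fun x _ => (isOpen_cylinder (E x) x).mem_nhds fun _ _ => rfl)
  have key : ∀ x ∈ X, ∀ y ∈ X, (∀ m ∈ t.biUnion E, x m = y m) → τ x 1 = τ y 1 := by
    intro x hx y hy hxy
    obtain ⟨z, hz, hxz⟩ := Set.mem_iUnion₂.1 (ht hx)
    rw [hE z (htX z hz) x hx hxz, hE z (htX z hz) y hy fun e he => ?_]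
    rw [← hxy e (Finset.mem_biUnion.2 ⟨z, hz, he⟩), hxz e he]
  refine ⟨t.biUnion E, fun x hx y hy g h => ?_⟩
  have := key _ (hX.2 g⁻¹ x hx) _ (hX.2 g⁻¹ y hy) fun m hm => by
    simpa only [shift_inv_apply] using h m hm
  simpa only [hτ.2.2 _ x hx, hτ.2.2 _ y hy, shift_inv_apply, mul_one] using this

/-- By compactness, the second window in the definition of `Δ`-irreducibility may be infinite. -/
theorem DeltaIrreducible.exists_of_infinite {A : Type*} [Finite A]
    [TopologicalSpace A] [DiscreteTopology A] {X : Set (G → A)} (hX : IsClosed X)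
    {Δ : Finset G} (h : DeltaIrreducible Δ X) (Ω₁ : Finset G) (Ω₂ : Set G)
    (hΩ : plusNbhd (Ω₁ : Set G) (Δ : Set G) ∩ Ω₂ = ∅)
    {x₁ x₂ : G → A} (hx₁ : x₁ ∈ X) (hx₂ : x₂ ∈ X) :
    ∃ x ∈ X, (∀ g ∈ Ω₁, x g = x₁ g) ∧ ∀ g ∈ Ω₂, x g = x₂ g := by
  classical
  have hcl : ∀ (y : G → A) (g : G), IsClosed {x : G → A | x g = y g} := fun y g =>
    isClosed_eq (continuous_apply g) continuous_const
  have hK : IsCompact (X ∩ ⋂ g ∈ Ω₁, {x : G → A | x g = x₁ g}) :=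
    (hX.inter (isClosed_biInter fun g _ => hcl x₁ g)).isCompact
  obtain ⟨x, ⟨hxX, hx1⟩, hx2⟩ := hK.inter_iInter_nonempty
    (fun g : Ω₂ => {x : G → A | x g = x₂ g}) (fun g => hcl x₂ g) (fun u => by
      obtain ⟨x, hx, h1, h2⟩ := h Ω₁ (u.image Subtype.val) (by
        refine Set.subset_eq_empty (Set.inter_subset_inter_right _ ?_) hΩ
        intro g hg
        simp only [Finset.coe_image, Set.mem_image] at hg
        obtain ⟨a, -, rfl⟩ := hg
        exact a.2) x₁ hx₁ x₂ hx₂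
      refine ⟨x, ⟨hx, Set.mem_iInter₂.2 h1⟩, Set.mem_iInter₂.2 fun g hg => ?_⟩
      exact h2 g (Finset.mem_image_of_mem _ hg))
  exact ⟨x, hxX, Set.mem_iInter₂.1 hx1, fun g hg => Set.mem_iInter.1 hx2 ⟨g, hg⟩⟩

/-- A finite set contains a packing by translates of `E` of at least proportional size. -/
theorem exists_packing [DecidableEq G] (F E : Finset G) (hE : E.Nonempty) :
    ∃ T ⊆ F, (∀ s ∈ T, ∀ t ∈ T, s ≠ t → ∀ d ∈ E, ∀ e ∈ E, s * d ≠ t * e) ∧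
      F.card ≤ T.card * (E.card * E.card) := by
  classical
  let P : Finset G → Prop := fun T =>
    ∀ s ∈ T, ∀ t ∈ T, s ≠ t → ∀ d ∈ E, ∀ e ∈ E, s * d ≠ t * e
  obtain ⟨T, hT, hmax⟩ := Finset.exists_max_image (F.powerset.filter P) Finset.card
    ⟨∅, by simp [P]⟩
  simp only [Finset.mem_filter, Finset.mem_powerset] at hT hmax
  refine ⟨T, hT.1, hT.2, ?_⟩
  suffices hsub : F ⊆ T * (E * E⁻¹) by
    calc F.card ≤ (T * (E * E⁻¹)).card := Finset.card_le_card hsub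
      _ ≤ T.card * (E * E⁻¹).card := Finset.card_mul_le
      _ ≤ T.card * (E.card * E.card) := by
        gcongr
        exact Finset.card_mul_le.trans (by rw [Finset.card_inv])
  intro f hf
  by_contra hfT
  have hdisj : ∀ t ∈ T, ∀ d ∈ E, ∀ e ∈ E, t * d ≠ f * e := by
    intro t ht d hd e he h
    refine hfT (Finset.mem_mul.2 ⟨t, ht, d * e⁻¹,
      Finset.mul_mem_mul hd (Finset.inv_mem_inv he), ?_⟩)
    rw [← mul_assoc, h, mul_inv_cancel_right]
  have hfnot : f ∉ T := fun h => by
    obtain ⟨e, he⟩ := hE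
    exact hdisj f h e he e he rfl
  have hle := hmax (insert f T) ⟨Finset.insert_subset hf hT.1, by
    intro s hs t ht hst d hd e he
    rcases Finset.mem_insert.1 hs with rfl | hs' <;> rcases Finset.mem_insert.1 ht with rfl | ht'
    · exact absurd rfl hst
    · exact (hdisj t ht' e he d hd).symm
    · exact hdisj s hs' d hd e he
    · exact hT.2 s hs' t ht' hst d hd e he⟩
  rw [Finset.card_insert_of_notMem hfnot] at hle
  omega

/-- The configurations in `X` in which the pattern `p|_E` occurs at no position of `T`. -/
def avoiding {A : Type*} (X : Set (G → A)) (E : Finset G) (p : G → A) (T : Finset G) :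
    Set (G → A) :=
  {x ∈ X | ∀ t ∈ T, ∃ e ∈ E, x (t * e) ≠ p e}

/-- Forbidding a pattern at one more position removes a definite proportion of the patterns. -/
theorem ncard_restrict_avoiding_insert_le {A : Type*} [Fintype A] [Nonempty A]
    [TopologicalSpace A] [DecidableEq G] {X : Set (G → A)} (hX : IsSubshift X) {Δ : Finset G}
    (hΔ : DeltaIrreducible Δ X) {E D Ω T : Finset G} {p : G → A} (hp : p ∈ X)
    (hED : E ⊆ D) (hEΔ : E * Δ⁻¹ ⊆ D) {t : G}
    (hdisj : ∀ s ∈ T, ∀ d ∈ D, ∀ e ∈ D, s * d ≠ t * e)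
    (hTΩ : ∀ s ∈ insert t T, ∀ d ∈ D, s * d ∈ Ω) :
    Fintype.card A ^ D.card * (Ω.restrict '' avoiding X E p (insert t T)).ncard ≤
      (Fintype.card A ^ D.card - 1) * (Ω.restrict '' avoiding X E p T).ncard := by
  classical
  set Z := Ω.restrict '' avoiding X E p T with hZ
  set Z' := Ω.restrict '' avoiding X E p (insert t T) with hZ'
  have hsub : Z' ⊆ Z := Set.image_mono fun x hx =>
    ⟨hx.1, fun s hs => hx.2 s (Finset.mem_insert_of_mem hs)⟩
  have hrep : ∀ q ∈ Z, ∃ x ∈ X, ∃ x' ∈ X, Ω.restrict x = q ∧ Ω.restrict x' ∈ Z \ Z' ∧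
      ∀ g ∈ Ω, (∀ d ∈ D, g ≠ t * d) → x' g = x g := by
    rintro q ⟨x, hx, rfl⟩
    obtain ⟨x', hx', h1, h2⟩ := hΔ (E.image (t * ·)) (Ω.filter fun g => ∀ d ∈ D, g ≠ t * d)
      (by
        rw [Set.eq_empty_iff_forall_notMem]
        rintro g ⟨⟨d, hd, hgd⟩, hg⟩
        simp only [Finset.coe_image, Set.mem_image, Finset.mem_coe] at hgd
        obtain ⟨e, he, hge⟩ := hgd
        refine (Finset.mem_filter.1 hg).2 (e * d⁻¹)
          (hEΔ (Finset.mul_mem_mul he (Finset.inv_mem_inv hd))) ?_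
        rw [← mul_assoc, hge, mul_inv_cancel_right])
      (shift t p) (hX.2 t p hp) x hx.1
    have h2' : ∀ g ∈ Ω, (∀ d ∈ D, g ≠ t * d) → x' g = x g := fun g hg hgd =>
      h2 g (Finset.mem_filter.2 ⟨hg, hgd⟩)
    refine ⟨x, hx.1, x', hx', rfl, ⟨⟨x', ⟨hx', fun s hs => ?_⟩, rfl⟩, ?_⟩, h2'⟩
    · obtain ⟨e, he, hxe⟩ := hx.2 s hs
      refine ⟨e, he, ?_⟩
      rwa [h2' _ (hTΩ s (Finset.mem_insert_of_mem hs) e (hED he))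
        fun d hd => hdisj s hs e (hED he) d hd]
    · rintro ⟨z, hz, hzx⟩
      obtain ⟨e, he, hze⟩ := hz.2 t (Finset.mem_insert_self t T)
      apply hze
      have := congrFun hzx ⟨t * e, hTΩ t (Finset.mem_insert_self t T) e (hED he)⟩
      simp only [Finset.restrict_def] at this
      rw [this, h1 _ (Finset.mem_image_of_mem _ he)]
      simp [shift]
  choose! x hx x' hx' hxq hx'Z hxx' using hrep
  have hle : Z.ncard ≤ (Z \ Z').ncard * Fintype.card A ^ D.card := by
    have := Set.ncard_le_ncard_of_injOn (s := Z) (t := (Z \ Z') ×ˢ (Set.univ : Set (D → A)))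
      (fun q => (Ω.restrict (x' q), fun d : D => x q (t * d)))
      (fun q hq => ⟨hx'Z q hq, Set.mem_univ _⟩)
      (by
        intro q hq r hr hqr
        simp only [Prod.mk.injEq] at hqr
        rw [← hxq q hq, ← hxq r hr]
        funext g
        simp only [Finset.restrict_def]
        by_cases hg : ∀ d ∈ D, (g : G) ≠ t * d
        · rw [← hxx' q hq g g.2 hg, ← hxx' r hr g g.2 hg]
          exact congrFun hqr.1 g
        · push Not at hg
          obtain ⟨d, hd, hgd⟩ := hg
          rw [hgd]
          exact congrFun hqr.2 ⟨d, hd⟩)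
      (Set.toFinite _)
    simpa [Set.ncard_prod, Set.ncard_univ, Nat.card_eq_fintype_card] using this
  have hadd := Set.ncard_sdiff_add_ncard_of_subset hsub
  rw [← hadd, Nat.sub_mul, one_mul, mul_add]
  rw [← hadd] at hle
  rw [mul_comm (Fintype.card A ^ D.card) (Z \ Z').ncard]
  omega

theorem ncard_restrict_avoiding_le {A : Type*} [Fintype A] [Nonempty A]
    [TopologicalSpace A] [DecidableEq G] {X : Set (G → A)} (hX : IsSubshift X) {Δ : Finset G}
    (hΔ : DeltaIrreducible Δ X) {E D Ω : Finset G} {p : G → A} (hp : p ∈ X)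
    (hED : E ⊆ D) (hEΔ : E * Δ⁻¹ ⊆ D) (T : Finset G)
    (hdisj : ∀ s ∈ T, ∀ t ∈ T, s ≠ t → ∀ d ∈ D, ∀ e ∈ D, s * d ≠ t * e)
    (hTΩ : ∀ s ∈ T, ∀ d ∈ D, s * d ∈ Ω) :
    (Fintype.card A ^ D.card) ^ T.card * (Ω.restrict '' avoiding X E p T).ncard ≤
      (Fintype.card A ^ D.card - 1) ^ T.card * (Ω.restrict '' X).ncard := by
  induction T using Finset.induction_on with
  | empty => simp [avoiding]
  | insert t T ht ih =>
    have ih' := ih (fun s hs u hu => hdisj s (Finset.mem_insert_of_mem hs) u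
      (Finset.mem_insert_of_mem hu)) fun s hs => hTΩ s (Finset.mem_insert_of_mem hs)
    have hstep := ncard_restrict_avoiding_insert_le hX hΔ hp hED hEΔ (T := T) (t := t) (Ω := Ω)
      (fun s hs => hdisj s (Finset.mem_insert_of_mem hs) t (Finset.mem_insert_self t T)
        fun h => ht (h ▸ hs)) hTΩ
    rw [Finset.card_insert_of_notMem ht, pow_succ, pow_succ, mul_assoc]
    calc _ ≤ (Fintype.card A ^ D.card) ^ T.card * ((Fintype.card A ^ D.card - 1) *
          (Ω.restrict '' avoiding X E p T).ncard) := Nat.mul_le_mul_left _ hstep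
      _ = (Fintype.card A ^ D.card - 1) * ((Fintype.card A ^ D.card) ^ T.card *
          (Ω.restrict '' avoiding X E p T).ncard) := by ring
      _ ≤ (Fintype.card A ^ D.card - 1) * ((Fintype.card A ^ D.card - 1) ^ T.card *
          (Ω.restrict '' X).ncard) := Nat.mul_le_mul_left _ ih'
      _ = _ := by ring

theorem ncard_restrict_image_le {ι A : Type*} [Fintype A] [Nonempty A] [DecidableEq ι]
    (Y : Set (ι → A)) (Ω Ω' : Finset ι) :
    (Ω'.restrict '' Y).ncard ≤
      (Ω.restrict '' Y).ncard * Fintype.card A ^ (Ω' \ Ω).card := by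
  have hrep : ∀ q ∈ Ω'.restrict '' Y, ∃ y ∈ Y, Ω'.restrict y = q := fun q hq => hq
  choose! y hy hyq using hrep
  have := Set.ncard_le_ncard_of_injOn (s := Ω'.restrict '' Y)
    (t := (Ω.restrict '' Y) ×ˢ (Set.univ : Set ((Ω' \ Ω : Finset ι) → A)))
    (fun q => (Ω.restrict (y q), (Ω' \ Ω).restrict (y q)))
    (fun q hq => ⟨⟨y q, hy q hq, rfl⟩, Set.mem_univ _⟩)
    (by
      intro q hq r hr hqr
      simp only [Prod.mk.injEq] at hqr
      rw [← hyq q hq, ← hyq r hr]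
      funext g
      simp only [Finset.restrict_def]
      by_cases hg : (g : ι) ∈ Ω
      · exact congrFun hqr.1 ⟨g, hg⟩
      · exact congrFun hqr.2 ⟨g, Finset.mem_sdiff.2 ⟨g.2, hg⟩⟩)
    (Set.toFinite _)
  rwa [Set.ncard_prod, Set.ncard_univ, Nat.card_eq_fintype_card, Fintype.card_fun,
    Fintype.card_coe] at this

/-- A pre-injective cellular automaton does not lose patterns, up to enlarging the window. -/
theorem PreInjective.ncard_restrict_le {A : Type*} [Finite A] [Nonempty A] [DecidableEq G]
    [TopologicalSpace A] [DiscreteTopology A] {X : Set (G → A)} (hX : IsClosed X)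
    {Δ : Finset G} (hΔ : DeltaIrreducible Δ X) {τ : (G → A) → (G → A)}
    (hpre : PreInjective X τ) {M : Finset G}
    (hM : ∀ x ∈ X, ∀ y ∈ X, ∀ g : G, (∀ m ∈ M, x (g * m) = y (g * m)) → τ x g = τ y g)
    (Ω : Finset G) :
    (Ω.restrict '' X).ncard ≤ ((Ω * Δ⁻¹ * M⁻¹).restrict '' (τ '' X)).ncard := by
  rcases X.eq_empty_or_nonempty with rfl | ⟨x₀, hx₀⟩
  · simp
  have hrep : ∀ q ∈ Ω.restrict '' X, ∃ x ∈ X, Ω.restrict x = q ∧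
      ∀ g ∉ Ω * Δ⁻¹, x g = x₀ g := by
    rintro q ⟨z, hz, rfl⟩
    obtain ⟨x, hx, h1, h2⟩ := hΔ.exists_of_infinite hX Ω {g | g ∉ Ω * Δ⁻¹} (by
      rw [Set.eq_empty_iff_forall_notMem]
      rintro g ⟨⟨d, hd, hgd⟩, hg⟩
      exact hg (Finset.mem_mul.2 ⟨g * d, hgd, d⁻¹, Finset.inv_mem_inv hd, by simp⟩)) hz hx₀
    exact ⟨x, hx, funext fun g => h1 g g.2, h2⟩
  choose! x hx hxq hx0 using hrep
  have hout : ∀ q ∈ Ω.restrict '' X, ∀ g ∉ Ω * Δ⁻¹ * M⁻¹, τ (x q) g = τ x₀ g := by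
    intro q hq g hg
    refine hM _ (hx q hq) _ hx₀ g fun m hm => hx0 q hq _ fun hgm => hg ?_
    exact Finset.mem_mul.2 ⟨g * m, hgm, m⁻¹, Finset.inv_mem_inv hm, by simp⟩
  refine Set.ncard_le_ncard_of_injOn (fun q => (Ω * Δ⁻¹ * M⁻¹).restrict (τ (x q)))
    (fun q hq => ⟨_, ⟨_, hx q hq, rfl⟩, rfl⟩) ?_ (Set.toFinite _)
  intro q hq r hr hqr
  have hτ : τ (x q) = τ (x r) := by
    funext g
    by_cases hg : g ∈ Ω * Δ⁻¹ * M⁻¹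
    · exact congrFun hqr ⟨g, hg⟩
    · rw [hout q hq g hg, hout r hr g hg]
  rw [← hxq q hq, ← hxq r hr]
  refine congrArg _ (hpre _ (hx q hq) _ (hx r hr) ?_ hτ)
  refine (Ω * Δ⁻¹).finite_toSet.subset fun g hg => ?_
  by_contra hg'
  exact hg ((hx0 q hq g hg').trans (hx0 r hr g hg').symm)

/-- Along a Følner net, boundaries are eventually smaller than any given proportion. -/
theorem IsFolnerNet.exists_mul_card_lt [DecidableEq G] {J : Type*} [Nonempty J] [Preorder J]
    [IsDirected J (· ≤ ·)] {F : J → Finset G} (hF : IsFolnerNet F) (K : Finset G) (N : ℕ) :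
    ∃ j, N * ((F j * K) \ F j).card < (F j).card := by
  obtain ⟨j, hj⟩ := ((hF.2 K⁻¹).eventually_lt_const
    (show (0 : ℝ) < 1 / (N + 1) by positivity)).exists
  refine ⟨j, ?_⟩
  have hset : plusNbhd (F j : Set G) ((K⁻¹ : Finset G) : Set G) \ (F j : Set G) =
      (((F j * K) \ F j : Finset G) : Set G) := by
    ext g
    simp only [plusNbhd, Set.mem_sdiff, Set.mem_ofPred_eq, Finset.coe_sdiff, Finset.mem_coe,
      Finset.mem_mul]
    refine and_congr_left fun _ => ⟨?_, ?_⟩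
    · rintro ⟨d, hd, hgd⟩
      exact ⟨g * d, hgd, d⁻¹, by simpa using hd, by simp⟩
    · rintro ⟨f, hf, k, hk, rfl⟩
      exact ⟨k⁻¹, by simpa using hk, by simpa using hf⟩
  rw [hset, Set.ncard_coe_finset] at hj
  have hpos : (0 : ℝ) < (F j).card := by exact_mod_cast (hF.1 j).card_pos
  rw [div_lt_div_iff₀ hpos (by positivity)] at hj
  have hj' : ((F j * K) \ F j).card * (N + 1) < 1 * (F j).card := by exact_mod_cast hj
  nlinarith

theorem exists_pred_pow_mul_le_pow {m : ℕ} (hm : 0 < m) (a : ℕ) :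
    ∃ N : ℕ, (m - 1) ^ N * a ≤ m ^ N := by
  rcases a.eq_zero_or_pos with rfl | ha
  · exact ⟨0, by simp⟩
  have hmR : (0 : ℝ) < m := by exact_mod_cast hm
  have haR : (0 : ℝ) < a := by exact_mod_cast ha
  obtain ⟨N, hN⟩ := exists_pow_lt_of_lt_one (show (0 : ℝ) < 1 / a by positivity)
    (show ((m - 1 : ℕ) : ℝ) / m < 1 by
      rw [div_lt_one hmR]; exact_mod_cast Nat.sub_lt hm one_pos)
  refine ⟨N, ?_⟩
  rw [div_pow, div_lt_div_iff₀ (by positivity) haR, one_mul] at hN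
  exact_mod_cast hN.le

theorem pred_pow_mul_pow_lt_pow {m a N n b : ℕ} (hm : 0 < m) (hN : (m - 1) ^ N * a ≤ m ^ N)
    (hn : N * b < n) : (m - 1) ^ n * a ^ b < m ^ n := by
  obtain ⟨r, rfl⟩ := Nat.exists_eq_add_of_lt hn
  calc (m - 1) ^ (N * b + r + 1) * a ^ b
      = ((m - 1) ^ N * a) ^ b * (m - 1) ^ (r + 1) := by rw [mul_pow, ← pow_mul]; ring
    _ ≤ (m ^ N) ^ b * (m - 1) ^ (r + 1) := by gcongr
    _ < (m ^ N) ^ b * m ^ (r + 1) := by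
        refine Nat.mul_lt_mul_of_pos_left ?_ (by positivity)
        exact Nat.pow_lt_pow_left (Nat.sub_lt hm one_pos) (Nat.succ_ne_zero r)
    _ = m ^ (N * b + r + 1) := by rw [← pow_mul]; ring

/-- Theorem (Myhill property): over an amenable group `G` and finite alphabet `A`,
every pre-injective cellular automaton on a strongly irreducible subshift is surjective. -/
theorem myhill_strongly_irreducible {A : Type*} [Fintype A]
    [TopologicalSpace A] [DiscreteTopology A]
    {J : Type*} [Nonempty J] [Preorder J] [IsDirected J (· ≤ ·)]
    (F : J → Finset G) (hF : IsFolnerNet F)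
    (X : Set (G → A)) (hX : IsSubshift X) (hSI : StronglyIrreducible X)
    (τ : (G → A) → (G → A)) (hτ : IsCellularAutomaton X X τ)
    (hpre : PreInjective X τ) :
    Set.SurjOn τ X X := by
  classical
  intro p hp
  by_contra hpY
  obtain ⟨Δ, hΔ⟩ := hSI
  obtain ⟨M, hM⟩ := hτ.exists_memory hX
  have hclosed : IsClosed (τ '' X) := (hX.1.isCompact.image_of_continuousOn hτ.2.1).isClosed
  obtain ⟨E, hE⟩ := exists_cylinder_subset (hclosed.isOpen_compl.mem_nhds hpY)
  have : Nonempty A := ⟨p 1⟩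
  let D : Finset G := insert 1 (E ∪ E * Δ⁻¹)
  have hED : E ⊆ D := Finset.subset_union_left.trans (Finset.subset_insert _ _)
  have hEΔ : E * Δ⁻¹ ⊆ D := Finset.subset_union_right.trans (Finset.subset_insert _ _)
  have h1D : (1 : G) ∈ D := Finset.mem_insert_self _ _
  set m := Fintype.card A ^ D.card with hm_def
  have hm : 0 < m := pow_pos Fintype.card_pos _
  obtain ⟨N, hN⟩ := exists_pred_pow_mul_le_pow hm (Fintype.card A)
  obtain ⟨j, hj⟩ := hF.exists_mul_card_lt (D * Δ⁻¹ * M⁻¹) (N * (D.card * D.card))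
  obtain ⟨T, hTF, hTdisj, hTcard⟩ := exists_packing (F j) D ⟨1, h1D⟩
  set Ω := F j * D with hΩ_def
  have hbdry : ((Ω * Δ⁻¹ * M⁻¹) \ Ω).card ≤ ((F j * (D * Δ⁻¹ * M⁻¹)) \ F j).card := by
    refine Finset.card_le_card ?_
    rw [hΩ_def, ← mul_assoc, ← mul_assoc]
    exact Finset.sdiff_subset_sdiff subset_rfl fun f hf =>
      Finset.mem_mul.2 ⟨f, hf, 1, h1D, mul_one f⟩
  set b := ((Ω * Δ⁻¹ * M⁻¹) \ Ω).card
  have hn : N * b < T.card := by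
    have hk : 0 < D.card * D.card := by
      have := Finset.card_pos.2 ⟨1, h1D⟩
      positivity
    refine Nat.lt_of_mul_lt_mul_right (a := D.card * D.card) ?_
    calc N * b * (D.card * D.card) = N * (D.card * D.card) * b := by ring
      _ ≤ N * (D.card * D.card) * ((F j * (D * Δ⁻¹ * M⁻¹)) \ F j).card := by gcongr
      _ < (F j).card := hj
      _ ≤ _ := hTcard
  have hYavoid : τ '' X ⊆ avoiding X E p T := by
    rintro _ ⟨y, hy, rfl⟩
    refine ⟨hτ.1 hy, fun t _ => ?_⟩
    by_contra! hcon
    refine hE (shift t⁻¹ (τ y)) (fun e he => ?_) ⟨shift t⁻¹ y, hX.2 _ y hy, hτ.2.2 _ y hy⟩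
    rw [shift_inv_apply, hcon e he]
  have hloss := ncard_restrict_avoiding_le hX hΔ hp hED hEΔ T hTdisj (Ω := Ω)
    fun s hs d hd => Finset.mul_mem_mul (hTF hs) hd
  have hgain := (hpre.ncard_restrict_le hX.1 hΔ hM Ω).trans
    (ncard_restrict_image_le (τ '' X) Ω (Ω * Δ⁻¹ * M⁻¹))
  have hmono : (Ω.restrict '' (τ '' X)).ncard ≤ (Ω.restrict '' avoiding X E p T).ncard :=
    Set.ncard_le_ncard (Set.image_mono hYavoid) (Set.toFinite _)
  have hpos : 0 < (Ω.restrict '' X).ncard :=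
    (Set.ncard_pos (Set.toFinite _)).2 ⟨_, p, hp, rfl⟩
  have hlt := pred_pow_mul_pow_lt_pow hm hN hn
  refine lt_irrefl (m ^ T.card * (Ω.restrict '' X).ncard) ?_
  calc m ^ T.card * (Ω.restrict '' X).ncard
      ≤ m ^ T.card * ((Ω.restrict '' avoiding X E p T).ncard * Fintype.card A ^ b) := by
        gcongr
        exact hgain.trans (Nat.mul_le_mul_right _ hmono)
    _ = m ^ T.card * (Ω.restrict '' avoiding X E p T).ncard * Fintype.card A ^ b := by ring
    _ ≤ (m - 1) ^ T.card * (Ω.restrict '' X).ncard * Fintype.card A ^ b :=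
        Nat.mul_le_mul_right _ hloss
    _ = (m - 1) ^ T.card * Fintype.card A ^ b * (Ω.restrict '' X).ncard := by ring
    _ < m ^ T.card * (Ω.restrict '' X).ncard := Nat.mul_lt_mul_of_pos_right hlt hpos
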